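/- arXiv:2402.14657 — 6 statements merged into one kernel-verified Lean document; each statement's English description precedes it below -/
import Mathlib

section
/- Fix an n×n complex matrix A, real numbers ε > 0 and δ > 0, and an index set {1,…,m}. Let E(t) be a path of n×n complex matrices differentiable at t₀, and for each i = 1,…,m let λᵢ(t) ∈ ℂ, xᵢ(t), yᵢ(t) ∈ ℂⁿ be differentiable at t₀ and satisfy, for all t near t₀: (A + εE(t)) yᵢ(t) = λᵢ(t) yᵢ(t), xᵢ(t)* (A + εE(t)) = λᵢ(t) xᵢ(t)*, ‖xᵢ(t)‖ = ‖yᵢ(t)‖ = 1, and xᵢ(t)* yᵢ(t) is real and strictly positive. Define F(t) = (1/2) Σᵢ₌₁^m ((Re λᵢ(t) + δ)₊)² and G(t) = Σᵢ₌₁^m γᵢ(t) xᵢ(t) yᵢ(t)*, where γᵢ(t) = (Re λᵢ(t) + δ)₊ / (xᵢ(t)* yᵢ(t)). Then F is differentiable at t₀ and F'(t₀) = ε · Re ⟨G(t₀), E'(t₀)⟩. -/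
open Matrix

/-- The Frobenius inner product `⟨X, Y⟩ = trace(X* Y)`. -/
noncomputable def frobInner {n : ℕ} (X Y : Matrix (Fin n) (Fin n) ℂ) : ℂ :=
  (Xᴴ * Y).trace

/-- The square of the positive part is differentiable, with derivative twice the positive part. -/
theorem hasDerivAt_max_zero_sq (a : ℝ) :
    HasDerivAt (fun s : ℝ => max s 0 ^ 2) (2 * max a 0) a := by
  rw [hasDerivAt_iff_isLittleO]
  have hbig : (fun s : ℝ => max s 0 ^ 2 - max a 0 ^ 2 - (s - a) • (2 * max a 0))
      =O[nhds a] fun s => ‖s - a‖ ^ 2 := by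
    refine Asymptotics.IsBigO.of_bound 1 (Filter.Eventually.of_forall fun s => ?_)
    rw [Real.norm_eq_abs, Real.norm_eq_abs, Real.norm_eq_abs, one_mul, sq_abs, abs_sq, smul_eq_mul,
      abs_le]
    rcases le_total s 0 with hs | hs <;> rcases le_total a 0 with ha | ha <;>
      simp only [max_eq_left, max_eq_right, hs, ha] <;>
      constructor <;> nlinarith
  refine hbig.trans_isLittleO ?_
  simpa using Asymptotics.isLittleO_pow_sub_sub a one_lt_two

/-- First-order perturbation of an eigenvalue: if `v` is a left eigenvector of `M t₀` and `y t` is a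
right eigenvector of `M t` for `lam t` near `t₀`, then `v M' y = lam' (v y)` at `t₀`. -/
theorem dotProduct_mulVec_eq_of_hasDerivAt_eigenvalue {ι : Type*} [Fintype ι]
    {M : ℝ → Matrix ι ι ℂ} {M' : Matrix ι ι ℂ} {t₀ : ℝ} {lam : ℝ → ℂ} {lam' : ℂ}
    {y : ℝ → ι → ℂ} {y' v : ι → ℂ}
    (hM : ∀ i j, HasDerivAt (fun t => M t i j) (M' i j) t₀)
    (hlam : HasDerivAt lam lam' t₀)
    (hy : ∀ k, HasDerivAt (fun t => y t k) (y' k) t₀)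
    (hright : ∀ᶠ t in nhds t₀, M t *ᵥ y t = lam t • y t)
    (hleft : v ᵥ* M t₀ = lam t₀ • v) :
    v ⬝ᵥ (M' *ᵥ y t₀) = lam' * (v ⬝ᵥ y t₀) := by
  have h₁ : HasDerivAt (fun t => v ⬝ᵥ (M t *ᵥ y t))
      (v ⬝ᵥ (M' *ᵥ y t₀ + M t₀ *ᵥ y')) t₀ := by
    simp only [dotProduct, mulVec, Pi.add_apply, ← Finset.sum_add_distrib]
    exact HasDerivAt.fun_sum fun i _ =>
      (HasDerivAt.fun_sum fun j _ => (hM i j).mul (hy j)).const_mul (v i)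
  have h₂ : HasDerivAt (fun t => lam t * (v ⬝ᵥ y t))
      (lam' * (v ⬝ᵥ y t₀) + lam t₀ * (v ⬝ᵥ y')) t₀ := by
    refine hlam.mul ?_
    simp only [dotProduct]
    exact HasDerivAt.fun_sum fun i _ => (hy i).const_mul (v i)
  have heq : (fun t => v ⬝ᵥ (M t *ᵥ y t)) =ᶠ[nhds t₀] fun t => lam t * (v ⬝ᵥ y t) := by
    filter_upwards [hright] with t ht
    rw [ht, dotProduct_smul, smul_eq_mul]
  have h := h₁.unique (h₂.congr_of_eventuallyEq heq)
  rw [dotProduct_add, dotProduct_mulVec v (M t₀), hleft, smul_dotProduct, smul_eq_mul] at h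
  exact add_right_cancel h

theorem frobInner_sum_smul_vecMulVec {n : ℕ} {ι : Type*} (s : Finset ι) (c : ι → ℂ)
    (x y : ι → Fin n → ℂ) (B : Matrix (Fin n) (Fin n) ℂ) :
    frobInner (∑ i ∈ s, c i • vecMulVec (x i) (star (y i))) B =
      ∑ i ∈ s, star (c i) * (star (x i) ⬝ᵥ (B *ᵥ y i)) := by
  simp only [frobInner, conjTranspose_sum, conjTranspose_smul, conjTranspose_vecMulVec, star_star,
    Finset.sum_mul, trace_sum, smul_mul, trace_smul, smul_eq_mul, vecMulVec_mul, trace_vecMulVec]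
  refine Finset.sum_congr rfl fun i _ => ?_
  rw [dotProduct_mulVec, dotProduct_comm]

/-- **Derivative of the stabilization functional `F_ε` along a matrix path.**
With `F(t) = (1/2) Σᵢ ((Re λᵢ(t) + δ)₊)²` and gradient
`G(t) = Σᵢ γᵢ(t) xᵢ(t) yᵢ(t)*`, `γᵢ = (Re λᵢ + δ)₊ / (xᵢ* yᵢ)`, one has
`F'(t₀) = ε · Re ⟨G(t₀), E'(t₀)⟩`. -/
theorem functional_derivative {n m : ℕ}
    (A : Matrix (Fin n) (Fin n) ℂ) (ε δ : ℝ) (hε : 0 < ε) (hδ : 0 < δ)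
    (E : ℝ → Matrix (Fin n) (Fin n) ℂ) (E' : Matrix (Fin n) (Fin n) ℂ) (t₀ : ℝ)
    (lam : Fin m → ℝ → ℂ) (lam' : Fin m → ℂ)
    (x y : Fin m → ℝ → Fin n → ℂ) (x' y' : Fin m → Fin n → ℂ)
    (hE : ∀ i j, HasDerivAt (fun t => E t i j) (E' i j) t₀)
    (hlam : ∀ i, HasDerivAt (lam i) (lam' i) t₀)
    (hx : ∀ i k, HasDerivAt (fun t => x i t k) (x' i k) t₀)
    (hy : ∀ i k, HasDerivAt (fun t => y i t k) (y' i k) t₀)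
    (heig : ∀ᶠ t in nhds t₀, ∀ i : Fin m,
      (A + ε • E t) *ᵥ y i t = lam i t • y i t ∧
      star (x i t) ᵥ* (A + ε • E t) = lam i t • star (x i t) ∧
      star (x i t) ⬝ᵥ x i t = 1 ∧ star (y i t) ⬝ᵥ y i t = 1 ∧
      (star (x i t) ⬝ᵥ y i t).im = 0 ∧ 0 < (star (x i t) ⬝ᵥ y i t).re) :
    HasDerivAt
      (fun t => (1 / 2 : ℝ) * ∑ i : Fin m, (max ((lam i t).re + δ) 0) ^ 2)
      (ε * (frobInner
        (∑ i : Fin m,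
          (((max ((lam i t₀).re + δ) 0 : ℝ) : ℂ) / (star (x i t₀) ⬝ᵥ y i t₀)) •
            vecMulVec (x i t₀) (star (y i t₀)))
        E').re) t₀ := by
  have hterm : ∀ i, HasDerivAt (fun t => max ((lam i t).re + δ) 0 ^ 2)
      (2 * max ((lam i t₀).re + δ) 0 * (lam' i).re) t₀ := fun i =>
    have hre : HasDerivAt (fun t => (lam i t).re + δ) (lam' i).re t₀ :=
      (Complex.reCLM.hasFDerivAt.comp_hasDerivAt t₀ (hlam i)).add_const δ
    (hasDerivAt_max_zero_sq _).comp t₀ hre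
  refine ((HasDerivAt.fun_sum fun i (_ : i ∈ Finset.univ) => hterm i).const_mul
    (1 / 2 : ℝ)).congr_deriv (Eq.symm ?_)
  rw [frobInner_sum_smul_vecMulVec, Complex.re_sum, Finset.mul_sum, Finset.mul_sum]
  refine Finset.sum_congr rfl fun i _ => ?_
  obtain ⟨-, hleft, -, -, him, hpos⟩ := heig.self_of_nhds i
  have hM : ∀ j k, HasDerivAt (fun t => (A + ε • E t) j k) ((ε • E') j k) t₀ := fun j k =>
    ((hE j k).const_smul ε).const_add (A j k)
  have hpert := dotProduct_mulVec_eq_of_hasDerivAt_eigenvalue hM (hlam i) (hy i)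
    (heig.mono fun t ht => (ht i).1) hleft
  rw [smul_mulVec, dotProduct_smul, Complex.real_smul] at hpert
  obtain ⟨r, hr⟩ : ∃ r : ℝ, star (x i t₀) ⬝ᵥ y i t₀ = r := ⟨_, Complex.ext rfl him⟩
  rw [hr, Complex.ofReal_re] at hpos
  rw [hr] at hpert ⊢
  have hpert_re := congrArg Complex.re hpert
  rw [Complex.re_ofReal_mul, Complex.re_mul_ofReal] at hpert_re
  rw [← Complex.ofReal_div, Complex.star_def, Complex.conj_ofReal, Complex.re_ofReal_mul,
    mul_left_comm, hpert_re]
  field_simp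
end

section
/- Let E⋆ and G be n×n complex matrices with ‖E⋆‖_F = 1 and G ≠ 0, and suppose E⋆ is a stationary point of the gradient system, i.e. −G + Re⟨G, E⋆⟩ E⋆ = 0. Then μ := Re⟨G, E⋆⟩ ≠ 0 and E⋆ = ν G with ν = 1/μ; in particular E⋆ is a nonzero real scalar multiple of G. Consequently, if G = Σᵢ₌₁^m γᵢ xᵢ yᵢ* is a sum of m rank-one matrices, then E⋆ = ν Σᵢ₌₁^m γᵢ xᵢ yᵢ* and the rank of E⋆ is at most m. -/
open Matrix

/-- The Frobenius norm `‖X‖_F = ⟨X, X⟩^{1/2}`. -/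
noncomputable def frobNorm {n : ℕ} (X : Matrix (Fin n) (Fin n) ℂ) : ℝ :=
  Real.sqrt (frobInner X X).re

/-- A sum of `m` real multiples of rank-one matrices has rank at most `m`. -/
theorem Matrix.rank_sum_smul_vecMulVec_le {n m : ℕ} (c : Fin m → ℝ) (x y : Fin m → Fin n → ℂ) :
    (∑ i, c i • vecMulVec (x i) (y i)).rank ≤ m := by
  have h : ∑ i, c i • vecMulVec (x i) (y i) =
      (of fun (a : Fin n) (i : Fin m) => c i • x i a) * (of y) := by
    ext a b
    simp [Matrix.sum_apply, Matrix.mul_apply, vecMulVec_apply, mul_assoc]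
  rw [h]
  exact (rank_mul_le_left _ _).trans (rank_le_width _)

/-- **Stationary points are low rank.** If `‖E⋆‖_F = 1`, `G ≠ 0` and
`−G + Re⟨G, E⋆⟩ E⋆ = 0`, then `μ = Re⟨G, E⋆⟩ ≠ 0` and `E⋆ = (1/μ) G`; in
particular if `G = Σᵢ₌₁^m γᵢ xᵢ yᵢ*` then `E⋆ = (1/μ) Σᵢ γᵢ xᵢ yᵢ*` and
`rank E⋆ ≤ m`. -/
theorem stationary_point_low_rank {n m : ℕ}
    (Estar G : Matrix (Fin n) (Fin n) ℂ)
    (hE : frobNorm Estar = 1) (hG : G ≠ 0)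
    (hstat : -G + (frobInner G Estar).re • Estar = 0)
    (γ : Fin m → ℝ) (x y : Fin m → Fin n → ℂ)
    (hGsum : G = ∑ i : Fin m, γ i • vecMulVec (x i) (star (y i))) :
    (frobInner G Estar).re ≠ 0 ∧
      Estar = ((frobInner G Estar).re)⁻¹ • G ∧
      Estar = ((frobInner G Estar).re)⁻¹ •
        ∑ i : Fin m, γ i • vecMulVec (x i) (star (y i)) ∧
      Estar.rank ≤ m := by
  have hG_eq : G = (frobInner G Estar).re • Estar := by
    rwa [neg_add_eq_zero] at hstat
  have hμ : (frobInner G Estar).re ≠ 0 := by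
    intro h
    rw [h, zero_smul] at hG_eq
    exact hG hG_eq
  have hE_eq : Estar = ((frobInner G Estar).re)⁻¹ • G :=
    (eq_inv_smul_iff₀ hμ).2 hG_eq.symm
  have hE_sum : Estar = ((frobInner G Estar).re)⁻¹ •
      ∑ i : Fin m, γ i • vecMulVec (x i) (star (y i)) := by
    rwa [← hGsum]
  refine ⟨hμ, hE_eq, hE_sum, ?_⟩
  rw [hE_sum, Finset.smul_sum]
  simp_rw [smul_smul]
  exact rank_sum_smul_vecMulVec_le _ x fun i => star (y i)
end

section
/- Let E(ε) be a path of n×n complex matrices, differentiable at ε₀, with ‖E(ε)‖_F = 1 for all ε in a neighborhood of ε₀. Let G be an n×n complex matrix satisfying the stationarity relation G = −‖G‖_F · E(ε₀). Then Re⟨G, E(ε₀) + ε₀ E'(ε₀)⟩ = −‖G‖_F. (In particular Re⟨G, E'(ε₀)⟩ = 0, since the unit-norm constraint forces Re⟨E(ε₀), E'(ε₀)⟩ = 0.) -/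
open Matrix

theorem frobInner_re {n : ℕ} (X Y : Matrix (Fin n) (Fin n) ℂ) :
    (frobInner X Y).re =
      ∑ i, ∑ j, ((X j i).re * (Y j i).re + (X j i).im * (Y j i).im) := by
  simp [frobInner, Matrix.trace, Matrix.mul_apply]

theorem frobInner_add_right {n : ℕ} (X Y Z : Matrix (Fin n) (Fin n) ℂ) :
    frobInner X (Y + Z) = frobInner X Y + frobInner X Z := by
  simp [frobInner, Matrix.mul_add]

theorem frobInner_smul_right {n : ℕ} (c : ℝ) (X Y : Matrix (Fin n) (Fin n) ℂ) :
    frobInner X (c • Y) = c • frobInner X Y := by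
  simp [frobInner]

theorem frobInner_smul_left {n : ℕ} (c : ℝ) (X Y : Matrix (Fin n) (Fin n) ℂ) :
    frobInner (c • X) Y = c • frobInner X Y := by
  simp [frobInner, Matrix.conjTranspose_smul]

theorem frobInner_self_re_of_frobNorm_eq_one {n : ℕ} {X : Matrix (Fin n) (Fin n) ℂ}
    (h : frobNorm X = 1) : (frobInner X X).re = 1 :=
  Real.sqrt_eq_one.mp h

theorem hasDerivAt_frobInner_self_re {n : ℕ} {E : ℝ → Matrix (Fin n) (Fin n) ℂ}
    {E' : Matrix (Fin n) (Fin n) ℂ} {ε₀ : ℝ}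
    (hE : ∀ i j, HasDerivAt (fun ε => E ε i j) (E' i j) ε₀) :
    HasDerivAt (fun ε => (frobInner (E ε) (E ε)).re)
      (2 * (frobInner (E ε₀) E').re) ε₀ := by
  simp only [frobInner_re, Finset.mul_sum]
  refine HasDerivAt.fun_sum fun i _ => HasDerivAt.fun_sum fun j _ => ?_
  have hre : HasDerivAt (fun ε => (E ε j i).re) (E' j i).re ε₀ :=
    Complex.reCLM.hasFDerivAt.comp_hasDerivAt ε₀ (hE j i)
  have him : HasDerivAt (fun ε => (E ε j i).im) (E' j i).im ε₀ :=
    Complex.imCLM.hasFDerivAt.comp_hasDerivAt ε₀ (hE j i)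
  exact ((hre.mul hre).add (him.mul him)).congr_deriv (by ring)

/-- A path of unit Frobenius norm is orthogonal to its velocity. -/
theorem frobInner_deriv_re_eq_zero {n : ℕ} {E : ℝ → Matrix (Fin n) (Fin n) ℂ}
    {E' : Matrix (Fin n) (Fin n) ℂ} {ε₀ : ℝ}
    (hE : ∀ i j, HasDerivAt (fun ε => E ε i j) (E' i j) ε₀)
    (hnorm : ∀ᶠ ε in nhds ε₀, frobNorm (E ε) = 1) :
    (frobInner (E ε₀) E').re = 0 := by
  have hconst : HasDerivAt (fun ε => (frobInner (E ε) (E ε)).re) 0 ε₀ :=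
    (hasDerivAt_const ε₀ (1 : ℝ)).congr_of_eventuallyEq
      (hnorm.mono fun _ => frobInner_self_re_of_frobNorm_eq_one)
  linarith [(hasDerivAt_frobInner_self_re hE).unique hconst]

/-- **Key computation for the outer-iteration derivative.** If `E(ε)` is a path
of unit Frobenius norm matrices differentiable at `ε₀`, and
`G = −‖G‖_F · E(ε₀)`, then `Re⟨G, E(ε₀) + ε₀ E'(ε₀)⟩ = −‖G‖_F`; in particular
`Re⟨G, E'(ε₀)⟩ = 0`. -/
theorem outer_derivative_stationary {n : ℕ}
    (E : ℝ → Matrix (Fin n) (Fin n) ℂ) (E' : Matrix (Fin n) (Fin n) ℂ) (ε₀ : ℝ)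
    (hE : ∀ i j, HasDerivAt (fun ε => E ε i j) (E' i j) ε₀)
    (hnorm : ∀ᶠ ε in nhds ε₀, frobNorm (E ε) = 1)
    (G : Matrix (Fin n) (Fin n) ℂ)
    (hG : G = (-(frobNorm G)) • E ε₀) :
    (frobInner G (E ε₀ + ε₀ • E')).re = -(frobNorm G) ∧
      (frobInner G E').re = 0 := by
  have horth := frobInner_deriv_re_eq_zero hE hnorm
  have hself := frobInner_self_re_of_frobNorm_eq_one hnorm.self_of_nhds
  have hinner (Y : Matrix (Fin n) (Fin n) ℂ) :
      (frobInner G Y).re = -(frobNorm G) * (frobInner (E ε₀) Y).re := by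
    conv_lhs => rw [hG, frobInner_smul_left, Complex.smul_re, smul_eq_mul]
  constructor
  · rw [hinner, frobInner_add_right, frobInner_smul_right, Complex.add_re, Complex.smul_re,
      horth, hself, smul_zero, add_zero, mul_one]
  · rw [hinner, horth, mul_zero]
end

section
/- Let 0 < δ₁ < δ₂, let ψ be the cubic Hermite polynomial (ψ(x) = 0 for x < −δ₂, ψ(x) = (x+δ₂)²(2x+3δ₁−δ₂)/(δ₁−δ₂)³ for −δ₂ ≤ x ≤ −δ₁, ψ(x) = 1 for x > −δ₁) with derivative ψ'(x) = 6(x+δ₂)(x+δ₁)/(δ₁−δ₂)³ on [−δ₂,−δ₁] and 0 elsewhere. Then for every ρ ∈ ℝ, the quantity (ρ+δ₂)₊ · (ψ'(ρ)(ρ+δ₂)₊ + 2ψ(ρ)) is nonnegative. -/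
/-- The cubic Hermite interpolating polynomial `ψ` used in the smoothed
stabilization functional. -/
noncomputable def psi (δ₁ δ₂ x : ℝ) : ℝ :=
  if x < -δ₂ then 0
  else if x ≤ -δ₁ then (x + δ₂) ^ 2 * (2 * x + 3 * δ₁ - δ₂) / (δ₁ - δ₂) ^ 3
  else 1

/-- The derivative of `psi`. -/
noncomputable def psi' (δ₁ δ₂ x : ℝ) : ℝ :=
  if -δ₂ ≤ x ∧ x ≤ -δ₁ then 6 * (x + δ₂) * (x + δ₁) / (δ₁ - δ₂) ^ 3 else 0

/-- **Nonnegativity of the gradient coefficients of the smoothed functional.**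
For `0 < δ₁ < δ₂` and every `ρ ∈ ℝ`,
`(ρ+δ₂)₊ · (ψ'(ρ)(ρ+δ₂)₊ + 2ψ(ρ)) ≥ 0`. -/
theorem kappa_nonneg (δ₁ δ₂ : ℝ) (h₁ : 0 < δ₁) (h₂ : δ₁ < δ₂) (ρ : ℝ) :
    0 ≤ max (ρ + δ₂) 0 * (psi' δ₁ δ₂ ρ * max (ρ + δ₂) 0 + 2 * psi δ₁ δ₂ ρ) := by
  rcases le_or_gt (ρ + δ₂) 0 with hneg | hpos
  · simp [max_eq_right hneg]
  rw [max_eq_left hpos.le]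
  refine mul_nonneg hpos.le ?_
  rcases le_or_gt ρ (-δ₁) with hle | hgt
  · rw [psi', psi, if_pos ⟨by linarith, hle⟩, if_neg (by linarith), if_pos hle]
    have hcube : (δ₁ - δ₂) ^ 3 < 0 := Odd.pow_neg (by decide) (sub_neg.mpr h₂)
    calc 0 ≤ (ρ + δ₂) ^ 2 * (10 * ρ + 12 * δ₁ - 2 * δ₂) / (δ₁ - δ₂) ^ 3 :=
          div_nonneg_of_nonpos
            (mul_nonpos_of_nonneg_of_nonpos (sq_nonneg _) (by linarith)) hcube.le
      _ = _ := by ring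
  · rw [psi', psi, if_neg fun h => hgt.not_ge h.2, if_neg (by linarith),
      if_neg hgt.not_ge]
    norm_num
end

section
/- For n ≥ 2, let Sₙ be the n×n complex Smoke matrix defined by (Sₙ)_{j,j} = exp(2πi·j/n) for j = 1,…,n, (Sₙ)_{j,j+1} = 1 for j = 1,…,n−1, (Sₙ)_{n,1} = 1, and all other entries zero. Then the characteristic polynomial of Sₙ satisfies det(Sₙ − λIₙ) = (−1)ⁿ(λⁿ − 2) for all λ ∈ ℂ; equivalently, det(λIₙ − Sₙ) = λⁿ − 2. -/
open Matrix

/-- The `n×n` Smoke matrix: diagonal entries are the `n`-th roots of unity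
`exp(2πi·j/n)` for `j = 1,…,n`, with ones on the superdiagonal and in the
bottom-left corner. -/
noncomputable def smoke (n : ℕ) : Matrix (Fin n) (Fin n) ℂ :=
  fun j k =>
    if (k : ℕ) = (j : ℕ) + 1 then 1
    else if (j : ℕ) = n - 1 ∧ (k : ℕ) = 0 then 1
    else if k = j then Complex.exp (2 * Real.pi * Complex.I * ((j : ℕ) + 1) / n)
    else 0

/-- The determinant of a matrix supported on the diagonal and on the cyclic superdiagonal, with
constant entry `c` on the latter. -/
theorem det_diagonal_add_cyclic {R : Type*} [CommRing R] (m : ℕ) (d : Fin (m + 2) → R) (c : R) :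
    (Matrix.of fun j k : Fin (m + 2) =>
      if k = j then d j
      else if (k : ℕ) = (j : ℕ) + 1 ∨ ((j : ℕ) = m + 1 ∧ (k : ℕ) = 0) then c
      else 0).det = ∏ j, d j + (-1) ^ (m + 1) * c ^ (m + 2) := by
  rw [det_succ_column_zero, Fin.sum_univ_succ, Fin.sum_univ_castSucc, Finset.sum_eq_zero,
    det_of_isUpperTriangular, det_of_isLowerTriangular]
  · simp only [Fin.prod_univ_succ d, Fin.succAbove_zero, Fin.succ_last, Fin.succAbove_last,
      submatrix_apply, of_apply, Fin.ext_iff, Fin.val_succ, Fin.val_castSucc, Fin.val_last,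
      Fin.val_zero]
    simp
    ring
  · intro i j hij
    have hij : (i : ℕ) < j := hij
    have hj := j.isLt
    simp only [Fin.succ_last, Fin.succAbove_last, submatrix_apply, of_apply, Fin.ext_iff,
      Fin.val_succ, Fin.val_castSucc]
    rw [if_neg (by omega), if_neg (by omega)]
  · intro i j hij
    have hij : (j : ℕ) < i := hij
    simp only [Fin.succAbove_zero, submatrix_apply, of_apply, Fin.ext_iff, Fin.val_succ]
    rw [if_neg (by omega), if_neg (by omega)]
  · intro i _
    have hi := i.isLt
    simp only [of_apply, Fin.ext_iff, Fin.val_succ, Fin.val_castSucc, Fin.val_zero]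
    rw [if_neg (by omega), if_neg (by omega), mul_zero, zero_mul]

theorem IsPrimitiveRoot.prod_fin_sub_pow_succ {R : Type*} [CommRing R] [IsDomain R] {n : ℕ}
    {ζ : R} (hn : 0 < n) (hζ : IsPrimitiveRoot ζ n) (x : R) :
    ∏ j : Fin n, (x - ζ ^ ((j : ℕ) + 1)) = x ^ n - 1 := by
  classical
  have h := congrArg (Polynomial.eval x) (Polynomial.X_pow_sub_one_eq_prod hn hζ)
  rw [Polynomial.nthRootsFinset, ← Multiset.toFinset_eq hζ.nthRoots_one_nodup,
    Polynomial.eval_prod] at h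
  simp only [Finset.prod_mk, hζ.nthRoots_eq hζ.pow_eq_one, Multiset.map_map] at h
  rw [Fin.prod_univ_eq_prod_range fun j => x - ζ ^ (j + 1)]
  simpa [Finset.prod, pow_succ, Function.comp_def] using h.symm

/-- **Characteristic polynomial of the Smoke matrix.** For `n ≥ 2`,
`det(Sₙ − λIₙ) = (−1)ⁿ (λⁿ − 2)`, equivalently `det(λIₙ − Sₙ) = λⁿ − 2`. -/
theorem smoke_charpoly (n : ℕ) (hn : 2 ≤ n) (lam : ℂ) :
    (smoke n - lam • (1 : Matrix (Fin n) (Fin n) ℂ)).det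
        = (-1 : ℂ) ^ n * (lam ^ n - 2) ∧
      (lam • (1 : Matrix (Fin n) (Fin n) ℂ) - smoke n).det = lam ^ n - 2 := by
  have key : (lam • (1 : Matrix (Fin n) (Fin n) ℂ) - smoke n).det = lam ^ n - 2 := by
    have hζ := Complex.isPrimitiveRoot_exp n (by omega)
    have hprod := hζ.prod_fin_sub_pow_succ (by omega) lam
    obtain ⟨m, rfl⟩ := Nat.exists_eq_add_of_le' hn
    have hdet := det_diagonal_add_cyclic m
      (fun j => lam - Complex.exp (2 * Real.pi * Complex.I / (m + 2 : ℕ)) ^ ((j : ℕ) + 1)) (-1)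
    rw [hprod, ← pow_add, Odd.neg_one_pow ⟨m + 1, by ring⟩] at hdet
    convert hdet using 1
    · congr 1
      ext j k
      simp only [smoke, Matrix.sub_apply, Matrix.smul_apply, one_apply, of_apply, Fin.ext_iff,
        smul_eq_mul, ← Complex.exp_nat_mul]
      have hexp : 2 * Real.pi * Complex.I * ((j : ℕ) + 1) / (m + 2 : ℕ)
          = (((j : ℕ) + 1 : ℕ) : ℂ) * (2 * Real.pi * Complex.I / (m + 2 : ℕ)) := by
        push_cast
        ring
      rw [hexp]
      split_ifs <;> first | omega | simp
    · ring
  refine ⟨?_, key⟩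
  rw [← neg_sub, det_neg, key, Fintype.card_fin]
end

section
/- Let E(t) = U(t) S(t) V(t)* be a differentiable factorized path of n×n complex matrices, where U(t), V(t) ∈ ℂ^{n×r} satisfy U(t)* U(t) = I_r and V(t)* V(t) = I_r, S(t) ∈ ℂ^{r×r} is invertible, and the gauge conditions U(t)* U̇(t) = 0 and V(t)* V̇(t) = 0 hold. Suppose E(t) satisfies the gradient system Ė = −G + μ E at time t, where G is an n×n complex matrix and μ = Re⟨G, E⟩. Then Ṡ = −U* G V + μ S and U̇ = −(I − U U*) G V S^{−1} at time t. -/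
open Matrix

/-- **Factorized form of the gradient system.** Let `E(t) = U(t) S(t) V(t)*`
with `U(t)* U(t) = I_r`, `V(t)* V(t) = I_r`, `S(t)` invertible, and gauge
conditions `U* U̇ = 0`, `V* V̇ = 0`. If `Ė = −G + μ E` with `μ = Re⟨G, E⟩`, then
`Ṡ = −U* G V + μ S` and `U̇ = −(I − U U*) G V S⁻¹`. -/
theorem factorized_gradient_system {n r : ℕ}
    (U V : ℝ → Matrix (Fin n) (Fin r) ℂ) (S : ℝ → Matrix (Fin r) (Fin r) ℂ)
    (U' V' : Matrix (Fin n) (Fin r) ℂ) (S' : Matrix (Fin r) (Fin r) ℂ)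
    (G : Matrix (Fin n) (Fin n) ℂ) (t : ℝ)
    (hU : ∀ i j, HasDerivAt (fun s => U s i j) (U' i j) t)
    (hS : ∀ i j, HasDerivAt (fun s => S s i j) (S' i j) t)
    (hV : ∀ i j, HasDerivAt (fun s => V s i j) (V' i j) t)
    (horthU : ∀ s : ℝ, (U s)ᴴ * U s = 1)
    (horthV : ∀ s : ℝ, (V s)ᴴ * V s = 1)
    (hSinv : ∀ s : ℝ, IsUnit (S s).det)
    (hgaugeU : (U t)ᴴ * U' = 0) (hgaugeV : (V t)ᴴ * V' = 0)
    (hODE : U' * S t * (V t)ᴴ + U t * S' * (V t)ᴴ + U t * S t * V'ᴴ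
        = -G + (frobInner G (U t * S t * (V t)ᴴ)).re • (U t * S t * (V t)ᴴ)) :
    S' = -((U t)ᴴ * G * V t) + (frobInner G (U t * S t * (V t)ᴴ)).re • S t ∧
      U' = -((1 - U t * (U t)ᴴ) * G * V t * (S t)⁻¹) := by
  have hV'V : V'ᴴ * V t = 0 := by
    simpa using congrArg conjTranspose hgaugeV
  generalize (frobInner G (U t * S t * (V t)ᴴ)).re = μ at hODE ⊢
  have hright : U' * S t + U t * S' = -(G * V t) + μ • (U t * S t) := by
    simpa only [Matrix.add_mul, Matrix.neg_mul, Matrix.smul_mul, Matrix.mul_assoc, horthV t,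
      hV'V, Matrix.mul_one, Matrix.mul_zero, add_zero] using congrArg (· * V t) hODE
  have hS' : S' = -((U t)ᴴ * G * V t) + μ • S t := by
    simpa only [Matrix.mul_add, Matrix.mul_neg, Matrix.mul_smul, ← Matrix.mul_assoc, horthU t,
      hgaugeU, Matrix.one_mul, Matrix.zero_mul, zero_add] using congrArg ((U t)ᴴ * ·) hright
  refine ⟨hS', ?_⟩
  have hU'S : U' * S t = -((1 - U t * (U t)ᴴ) * G * V t) := by
    rw [eq_sub_of_add_eq hright, hS']
    simp only [Matrix.mul_add, Matrix.mul_neg, Matrix.mul_smul, Matrix.sub_mul, Matrix.one_mul,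
      Matrix.mul_assoc]
    abel
  rw [← Matrix.neg_mul, ← hU'S, Matrix.mul_nonsing_inv_cancel_right _ _ (hSinv t)]
end
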